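/- The space of all derivations of W(2) is a 2-dimensional F-vector space. -/

import Mathlib

set_option maxSynthPendingDepth 3

/-- The 2-dimensional vector space `V₂ = F²`, with standard basis `v₁ = (1,0)`, `v₂ = (0,1)`. -/
abbrev V2 (F : Type*) [Field F] := Fin 2 → F

/-- The fixed vector `v₁` (the first standard basis vector of `V₂`). -/
noncomputable def v1 (F : Type*) [Field F] : V2 F := Pi.single 0 1

/-- `W(2)`: the space of all bilinear multiplications on `V₂`. -/
abbrev Wtwo (F : Type*) [Field F] := V2 F →ₗ[F] V2 F →ₗ[F] V2 F

variable {F : Type*} [Field F]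

/-- The Kantor product on `W(2)`:
`(A·B)(x,y) = A(v₁, B(x,y)) − B(A(v₁,x), y) − B(x, A(v₁,y))`. -/
noncomputable def wmul (A B : Wtwo F) : Wtwo F :=
  LinearMap.mk₂ F
    (fun x y => A (v1 F) (B x y) - B (A (v1 F) x) y - B x (A (v1 F) y))
    (fun x x' y => by simp only [map_add, LinearMap.add_apply]; abel)
    (fun c x y => by simp only [map_smul, LinearMap.smul_apply, smul_sub])
    (fun x y y' => by simp only [map_add, LinearMap.add_apply]; abel)
    (fun c x y => by simp only [map_smul, LinearMap.smul_apply, smul_sub])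

/-- A derivation of `W(2)`: a linear map satisfying the Leibniz rule. -/
def IsDerivation (D : Wtwo F →ₗ[F] Wtwo F) : Prop :=
  ∀ x y : Wtwo F, D (wmul x y) = wmul (D x) y + wmul x (D y)

theorem wmul_add_left (A A' B : Wtwo F) : wmul (A + A') B = wmul A B + wmul A' B := by
  apply LinearMap.ext; intro x; apply LinearMap.ext; intro y
  simp [wmul]; abel

theorem wmul_smul_left (c : F) (A B : Wtwo F) : wmul (c • A) B = c • wmul A B := by
  apply LinearMap.ext; intro x; apply LinearMap.ext; intro y
  simp [wmul, smul_sub]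

theorem wmul_add_right (A B B' : Wtwo F) : wmul A (B + B') = wmul A B + wmul A B' := by
  apply LinearMap.ext; intro x; apply LinearMap.ext; intro y
  simp [wmul]; abel

theorem wmul_smul_right (c : F) (A B : Wtwo F) : wmul A (c • B) = c • wmul A B := by
  apply LinearMap.ext; intro x; apply LinearMap.ext; intro y
  simp [wmul, smul_sub]

theorem wmul_sub_left (A A' B : Wtwo F) : wmul (A - A') B = wmul A B - wmul A' B := by
  apply LinearMap.ext; intro x; apply LinearMap.ext; intro y
  simp [wmul]; abel

theorem wmul_sub_right (A B B' : Wtwo F) : wmul A (B - B') = wmul A B - wmul A B' := by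
  apply LinearMap.ext; intro x; apply LinearMap.ext; intro y
  simp [wmul]; abel

theorem wmul_zero_left (B : Wtwo F) : wmul 0 B = 0 := by
  apply LinearMap.ext; intro x; apply LinearMap.ext; intro y
  simp [wmul]

theorem wmul_zero_right (A : Wtwo F) : wmul A 0 = 0 := by
  apply LinearMap.ext; intro x; apply LinearMap.ext; intro y
  simp [wmul]

/-- The space of all derivations of `W(2)`, as a submodule of the space of linear
endomorphisms of `W(2)`. -/
noncomputable def DerivationsOf (F : Type*) [Field F] : Submodule F (Wtwo F →ₗ[F] Wtwo F) where
  carrier := {D | IsDerivation D}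
  add_mem' := by
    intro A B hA hB
    simp only [Set.mem_setOf_eq, IsDerivation] at *
    intro x y
    simp only [LinearMap.add_apply, hA x y, hB x y, wmul_add_left, wmul_add_right]
    abel
  zero_mem' := by
    simp only [Set.mem_setOf_eq, IsDerivation]
    intro x y
    simp [wmul_zero_left, wmul_zero_right]
  smul_mem' := by
    intro c A hA
    simp only [Set.mem_setOf_eq, IsDerivation] at *
    intro x y
    simp only [LinearMap.smul_apply, hA x y, wmul_smul_left, wmul_smul_right, smul_add]

/-- The multiplication `(v, y) ↦ v 0 • x y`, whose left multiplication by the basis vector `v₁`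
is `x`. -/
def coordSection (F : Type*) [Field F] : Module.End F (V2 F) →ₗ[F] Wtwo F :=
  LinearMap.smulRightₗ (LinearMap.proj 0)

theorem coordSection_v1 (x : Module.End F (V2 F)) : coordSection F x (v1 F) = x := by
  ext; simp [coordSection, v1]

theorem wmul_apply (A B : Wtwo F) (p q : V2 F) :
    wmul A B p q = A (v1 F) (B p q) - B (A (v1 F) p) q - B p (A (v1 F) q) := rfl

/-- The natural action of `gl(V₂)` on the space of bilinear multiplications of `V₂`. -/
noncomputable def glAction (F : Type*) [Field F] :
    Module.End F (V2 F) →ₗ[F] Module.End F (Wtwo F) :=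
  LinearMap.mk₂ F (fun x B => wmul (coordSection F x) B)
    (fun x y B => by rw [map_add, wmul_add_left])
    (fun c x B => by rw [map_smul, wmul_smul_left])
    (fun x B C => wmul_add_right _ B C)
    (fun c x B => wmul_smul_right c _ B)

theorem glAction_apply (x : Module.End F (V2 F)) (B : Wtwo F) (p q : V2 F) :
    glAction F x B p q = x (B p q) - B (x p) q - B p (x q) := by
  change wmul (coordSection F x) B p q = _
  rw [wmul_apply, coordSection_v1]

theorem wmul_eq_glAction (A B : Wtwo F) : wmul A B = glAction F (A (v1 F)) B := by
  refine LinearMap.ext fun p => LinearMap.ext fun q => ?_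
  rw [wmul_apply, glAction_apply]

theorem glAction_lie (x y : Module.End F (V2 F)) (B : Wtwo F) :
    glAction F ⁅x, y⁆ B = glAction F x (glAction F y B) - glAction F y (glAction F x B) := by
  refine LinearMap.ext fun p => LinearMap.ext fun q => ?_
  simp only [glAction_apply, LinearMap.sub_apply, Ring.lie_def, Module.End.mul_apply, map_sub]
  abel

theorem glAction_injective : Function.Injective (glAction F) := by
  rw [injective_iff_map_eq_zero]
  intro z hz
  have key (i : Fin 2) (p : V2 F) : z p i = 0 := by
    have h := congr($hz (LinearMap.smulRight (LinearMap.proj i) LinearMap.id) p 1)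
    have h' := congrFun h 0
    simpa [glAction_apply] using h'
  exact LinearMap.ext fun p => funext fun i => key i p

theorem glAction_mem_derivationsOf {u : Module.End F (V2 F)} (hu : u (v1 F) = 0) :
    glAction F u ∈ DerivationsOf F := by
  intro A B
  have h : glAction F u A (v1 F) = ⁅u, A (v1 F)⁆ := by
    refine LinearMap.ext fun q => ?_
    simp [glAction_apply, hu, Ring.lie_def, Module.End.mul_apply]
  rw [wmul_eq_glAction, wmul_eq_glAction, wmul_eq_glAction, h, glAction_lie]
  abel

/-- A derivation of the Lie algebra `gl₂` which kills the identity and preserves the matrices with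
vanishing first column is the commutator with such a matrix. -/
theorem exists_eq_lie_of_preserves_col [NeZero (2 : F)]
    (d : Matrix (Fin 2) (Fin 2) F →ₗ[F] Matrix (Fin 2) (Fin 2) F)
    (hd : ∀ x y, d ⁅x, y⁆ = ⁅d x, y⁆ + ⁅x, d y⁆) (hone : d 1 = 0)
    (hcol : ∀ x, (∀ i, x i 0 = 0) → ∀ i, d x i 0 = 0) :
    ∃ u : Matrix (Fin 2) (Fin 2) F, (∀ i, u i 0 = 0) ∧ ∀ x, d x = ⁅u, x⁆ := by
  have two : (2 : F) ≠ 0 := NeZero.ne 2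
  have decomp (x : Matrix (Fin 2) (Fin 2) F) : x = x 0 0 • 1 + x 0 1 • !![0, 1; 0, 0] +
      x 1 0 • !![0, 0; 1, 0] + (x 1 1 - x 0 0) • !![0, 0; 0, 1] := by
    ext i j; fin_cases i <;> fin_cases j <;> simp
  have b1 : ⁅(!![0, 1; 0, 0] : Matrix (Fin 2) (Fin 2) F), (!![0, 0; 0, 1] : Matrix _ _ F)⁆ = !![0, 1; 0, 0] := by
    simp [Ring.lie_def]
  have b2 : ⁅(!![0, 0; 0, 1] : Matrix (Fin 2) (Fin 2) F), (!![0, 0; 1, 0] : Matrix _ _ F)⁆ = !![0, 0; 1, 0] := by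
    ext i j; fin_cases i <;> fin_cases j <;> simp [Ring.lie_def]
  have b3 : ⁅(!![0, 1; 0, 0] : Matrix (Fin 2) (Fin 2) F), (!![0, 0; 1, 0] : Matrix _ _ F)⁆ =
      1 - (2 : F) • !![0, 0; 0, 1] := by
    ext i j; fin_cases i <;> fin_cases j <;> simp [Ring.lie_def]; norm_num
  have c1 := hd !![0, 1; 0, 0] !![0, 0; 0, 1]
  have c2 := hd !![0, 0; 0, 1] !![0, 0; 1, 0]
  have c3 := hd !![0, 1; 0, 0] !![0, 0; 1, 0]
  rw [b1] at c1
  rw [b2] at c2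
  rw [b3, map_sub, hone, map_smul] at c3
  have k1 := hcol !![0, 1; 0, 0] (by intro i; fin_cases i <;> rfl)
  have k2 := hcol !![0, 0; 0, 1] (by intro i; fin_cases i <;> rfl)
  generalize hX : d !![0, 1; 0, 0] = X at *
  generalize hY : d !![0, 0; 1, 0] = Y at *
  generalize hZ : d !![0, 0; 0, 1] = Z at *
  rw [← Matrix.ext_iff] at c1 c2 c3
  simp only [Ring.lie_def, Fin.forall_fin_two, Matrix.add_apply, Matrix.sub_apply,
    Matrix.mul_apply, Fin.sum_univ_two, Matrix.smul_apply, Matrix.zero_apply, smul_eq_mul,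
    Matrix.of_apply, Matrix.cons_val_zero, Matrix.cons_val_one, mul_zero, zero_mul, mul_one,
    one_mul, add_zero, zero_add, sub_zero, zero_sub] at c1 c2 c3 k1 k2
  refine ⟨!![0, Z 0 1; 0, -X 0 1], by intro i; fin_cases i <;> rfl, fun x => ?_⟩
  conv_lhs => rw [decomp x]
  simp only [map_add, map_smul, hone, hX, hY, hZ]
  rw [← Matrix.ext_iff]
  simp only [Ring.lie_def, Fin.forall_fin_two, Matrix.add_apply, Matrix.sub_apply,
    Matrix.mul_apply, Fin.sum_univ_two, Matrix.smul_apply, Matrix.zero_apply, smul_eq_mul,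
    Matrix.of_apply, Matrix.cons_val_zero, Matrix.cons_val_one, smul_zero]
  clear hd hcol decomp
  grind

theorem exists_glAction_eq_of_mem_derivationsOf [NeZero (2 : F)] {D : Wtwo F →ₗ[F] Wtwo F}
    (hD : D ∈ DerivationsOf F) : ∃ u : Module.End F (V2 F), u (v1 F) = 0 ∧ glAction F u = D := by
  replace hD : IsDerivation D := hD
  let d : Module.End F (V2 F) →ₗ[F] Module.End F (V2 F) :=
    LinearMap.applyₗ (v1 F) ∘ₗ D ∘ₗ coordSection F
  have hcomm (x : Module.End F (V2 F)) (B : Wtwo F) :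
      D (glAction F x B) = glAction F (d x) B + glAction F x (D B) := by
    have h := hD (coordSection F x) B
    rwa [wmul_eq_glAction, wmul_eq_glAction, wmul_eq_glAction, coordSection_v1] at h
  have hv1 (A : Wtwo F) : D A (v1 F) = d (A (v1 F)) := by
    refine glAction_injective (LinearMap.ext fun B => ?_)
    have h := hD A B
    simp only [wmul_eq_glAction, hcomm] at h
    exact (add_right_cancel h).symm
  have hlie (x y : Module.End F (V2 F)) : d ⁅x, y⁆ = ⁅d x, y⁆ + ⁅x, d y⁆ := by
    refine glAction_injective (LinearMap.ext fun B => ?_)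
    have h := hcomm ⁅x, y⁆ B
    simp only [glAction_lie, map_sub, map_add, hcomm, LinearMap.add_apply] at h ⊢
    rw [← sub_eq_iff_eq_add] at h
    rw [← h]
    abel
  have hone : d 1 = 0 := by
    have h1 (B : Wtwo F) : glAction F 1 B = -B := by
      refine LinearMap.ext fun p => LinearMap.ext fun q => ?_
      simp [glAction_apply]
    refine glAction_injective (LinearMap.ext fun B => ?_)
    have h := hcomm 1 B
    simpa [h1] using h
  have hshift (x : Module.End F (V2 F)) (A : Wtwo F) :
      D A (x (v1 F)) = d (A (x (v1 F))) - A (d x (v1 F)) := by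
    have e (y : Module.End F (V2 F)) (B : Wtwo F) :
        glAction F y B (v1 F) = ⁅y, B (v1 F)⁆ - B (y (v1 F)) := by
      refine LinearMap.ext fun q => ?_
      simp only [glAction_apply, Ring.lie_def, Module.End.mul_apply, LinearMap.sub_apply]
      abel
    have h := hv1 (glAction F x A)
    rw [hcomm, LinearMap.add_apply, e, e, e, map_sub, hlie, hv1] at h
    rw [← sub_eq_zero] at h ⊢
    rw [← neg_eq_zero, ← h]
    abel
  have hcol (x : Module.End F (V2 F)) (hx : x (v1 F) = 0) : d x (v1 F) = 0 := by
    ext i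
    have h := congr($(hshift x (LinearMap.smulRight (LinearMap.proj i) LinearMap.id)) 1 0)
    simpa [hx] using h
  obtain ⟨u, hu0, hu⟩ : ∃ u : Module.End F (V2 F), u (v1 F) = 0 ∧ ∀ x, d x = ⁅u, x⁆ := by
    let e : Module.End F (V2 F) ≃ₐ[F] Matrix (Fin 2) (Fin 2) F := LinearMap.toMatrixAlgEquiv'
    have he (x : Module.End F (V2 F)) : x (v1 F) = 0 ↔ ∀ i, e x i 0 = 0 := by
      simp [e, funext_iff, LinearMap.toMatrixAlgEquiv'_apply, v1]
    have hbr (x y : Module.End F (V2 F)) : e ⁅x, y⁆ = ⁅e x, e y⁆ := by simp [Ring.lie_def]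
    obtain ⟨u, hu0, hu⟩ := exists_eq_lie_of_preserves_col
      (e.toLinearMap ∘ₗ d ∘ₗ e.symm.toLinearMap)
      (by
        refine e.surjective.forall₂.2 fun x y => ?_
        simp [← hbr, hlie])
      (by simp [hone])
      (by
        refine e.surjective.forall.2 fun x hx => ?_
        simpa using (he _).1 (hcol x ((he x).2 hx)))
    refine ⟨e.symm u, (he _).2 (by simpa using hu0), fun x => e.injective ?_⟩
    simpa [hbr] using hu (e x)
  refine ⟨u, hu0, LinearMap.ext fun A => LinearMap.ext fun p => ?_⟩
  obtain ⟨x, rfl⟩ : ∃ x : Module.End F (V2 F), x (v1 F) = p :=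
    ⟨LinearMap.smulRight (LinearMap.proj 0) p, by simp [v1]⟩
  rw [hshift, hu, hu]
  refine LinearMap.ext fun q => ?_
  simp only [glAction_apply, Ring.lie_def, Module.End.mul_apply, LinearMap.sub_apply, hu0,
    map_zero, sub_zero]
  abel

/-- The space of all derivations of `W(2)` is a 2-dimensional `F`-vector space. -/
theorem finrank_derivations {F : Type*} [Field F] [CharZero F] :
    Module.finrank F (DerivationsOf F) = 2 := by
  let ev : Module.End F (V2 F) →ₗ[F] V2 F := LinearMap.applyₗ (v1 F)
  have hmap : DerivationsOf F = (LinearMap.ker ev).map (glAction F) := by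
    ext D
    refine ⟨fun hD => ?_, ?_⟩
    · obtain ⟨u, hu, rfl⟩ := exists_glAction_eq_of_mem_derivationsOf hD
      exact ⟨u, hu, rfl⟩
    · rintro ⟨u, hu, rfl⟩
      exact glAction_mem_derivationsOf hu
  have hsurj : LinearMap.range ev = ⊤ := LinearMap.range_eq_top.2 fun p =>
    ⟨LinearMap.smulRight (LinearMap.proj 0) p, by simp [ev, v1]⟩
  have hrank := ev.finrank_range_add_finrank_ker
  rw [hsurj, finrank_top, Module.finrank_linearMap, Module.finrank_fin_fun] at hrank
  rw [hmap, ← (Submodule.equivMapOfInjective _ glAction_injective _).finrank_eq]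
  omega
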